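/- arXiv:2604.13189 — 3 statements merged into one kernel-verified Lean document; each statement's English description precedes it below -/
import Mathlib

section
/- If a topological dynamical system (X,T) has the partial shadowing property, then the product system (X×X, T×T) has the partial shadowing property (with respect to the max metric ρ_max((x₁,y₁),(x₂,y₂)) = max{ρ(x₁,x₂), ρ(y₁,y₂)}). -/
open Filter Finset
open scoped Classical

/-- The finite sequence `(x_i)_{i=0}^r` (with `r ≥ 1`) is a `δ`-partial pseudo-orbit for `T`. -/
def IsPartialPseudoOrbit {X : Type*} [PseudoMetricSpace X] (T : X → X) (δ : ℝ) (r : ℕ)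
    (x : ℕ → X) : Prop :=
  1 ≤ r ∧ 1 - δ <
    (((Finset.range r).filter (fun i => dist (T (x i)) (x (i + 1)) < δ)).card : ℝ) / (r : ℝ)

/-- The finite sequence `(x_i)_{i=0}^r` is `ε`-partially traced by `z`:
`|{0 ≤ i ≤ r : ρ(T^i(z), x_i) < ε}| / (r+1) > 1 - ε`. -/
def PartiallyTraces {X : Type*} [PseudoMetricSpace X] (T : X → X) (ε : ℝ) (r : ℕ)
    (x : ℕ → X) (z : X) : Prop :=
  1 - ε <
    (((Finset.range (r + 1)).filter (fun i => dist (T^[i] z) (x i) < ε)).card : ℝ) / ((r : ℝ) + 1)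

/-- `(X,T)` has the partial shadowing property. -/
def PartialShadowing {X : Type*} [PseudoMetricSpace X] (T : X → X) : Prop :=
  ∀ ε > (0 : ℝ), ∃ δ > (0 : ℝ), ∀ (r : ℕ) (x : ℕ → X),
    IsPartialPseudoOrbit T δ r x → ∃ z : X, PartiallyTraces T ε r x z

theorem IsPartialPseudoOrbit.map {X Y : Type*} [PseudoMetricSpace X] [PseudoMetricSpace Y]
    {T : X → X} {S : Y → Y} {π : X → Y} (hπ : ∀ a b, dist (π a) (π b) ≤ dist a b)
    (hTS : Function.Semiconj π T S) {δ : ℝ} {r : ℕ} {x : ℕ → X}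
    (hx : IsPartialPseudoOrbit T δ r x) :
    IsPartialPseudoOrbit S δ r (fun i => π (x i)) := by
  refine ⟨hx.1, hx.2.trans_le ?_⟩
  gcongr with i
  rw [← hTS (x i)]
  exact hπ _ _

theorem PartiallyTraces.prodMk {X Y : Type*} [PseudoMetricSpace X] [PseudoMetricSpace Y]
    {T : X → X} {S : Y → Y} {ε : ℝ} (hε : 0 < ε) {r : ℕ} {x : ℕ → X × Y} {z : X} {w : Y}
    (hz : PartiallyTraces T (ε / 2) r (fun i => (x i).1) z)
    (hw : PartiallyTraces S (ε / 2) r (fun i => (x i).2) w) :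
    PartiallyTraces (Prod.map T S) ε r x (z, w) := by
  unfold PartiallyTraces at *
  have hr : (0 : ℝ) < (r : ℝ) + 1 := by positivity
  rw [lt_div_iff₀ hr] at *
  set A := (range (r + 1)).filter (fun i => dist (T^[i] z) (x i).1 < ε / 2)
  set B := (range (r + 1)).filter (fun i => dist (S^[i] w) (x i).2 < ε / 2)
  have hinter : A ∩ B ⊆ (range (r + 1)).filter
      (fun i => dist ((Prod.map T S)^[i] (z, w)) (x i) < ε) := by
    intro i hi
    simp only [A, B, mem_inter, mem_filter] at hi
    rw [mem_filter, Prod.map_iterate, Prod.dist_eq, max_lt_iff]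
    exact ⟨hi.1.1, hi.1.2.trans (half_lt_self hε), hi.2.2.trans (half_lt_self hε)⟩
  have hunion : #(A ∪ B) ≤ r + 1 := by
    simpa using card_le_card (union_subset (filter_subset _ _) (filter_subset _ _) :
      A ∪ B ⊆ range (r + 1))
  have hcard : (#A : ℝ) + #B ≤ r + 1 + #(A ∩ B) := by
    have := card_union_add_card_inter A B
    exact_mod_cast (by omega : #A + #B ≤ r + 1 + #(A ∩ B))
  have hle : (#(A ∩ B) : ℝ) ≤ _ := Nat.cast_le.mpr (card_le_card hinter)
  linarith

/-- Partial shadowing passes to the product system `(X × X, T × T)` (the product carries the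
max metric `ρ_max((x₁,y₁),(x₂,y₂)) = max {ρ(x₁,x₂), ρ(y₁,y₂)}`, which is the metric of
`X × X` in Mathlib). -/
theorem stmt1 {X : Type*} [MetricSpace X] [CompactSpace X] (T : X → X) (hT : Continuous T)
    (h : PartialShadowing T) : PartialShadowing (Prod.map T T) := by
  intro ε hε
  obtain ⟨δ, hδ, hshadow⟩ := h (ε / 2) (half_pos hε)
  refine ⟨δ, hδ, fun r x hx => ?_⟩
  obtain ⟨z, hz⟩ := hshadow r _ (hx.map (π := Prod.fst) (S := T) (fun _ _ => le_max_left _ _)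
    (fun _ => rfl))
  obtain ⟨w, hw⟩ := hshadow r _ (hx.map (π := Prod.snd) (S := T) (fun _ _ => le_max_right _ _)
    (fun _ => rfl))
  exact ⟨(z, w), hz.prodMk hε hw⟩
end

section
/- If (X,T) is a surjective topological dynamical system, on a compact metric space of diameter at most 1, with the average shadowing property, then the set of ergodic T-invariant Borel probability measures on X is dense in the space of all T-invariant Borel probability measures on X endowed with the weak* topology. -/
open Filter Finset MeasureTheory
open scoped Classical

/-- `(x_i)_{i=0}^∞` is a `δ`-average pseudo-orbit for `T`. -/
def IsAvgPseudoOrbit {X : Type*} [MetricSpace X] (T : X → X) (δ : ℝ) (x : ℕ → X) : Prop :=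
  ∃ N : ℕ, ∀ n : ℕ, N ≤ n → ∀ k : ℕ,
    (1 / (n : ℝ)) * ∑ i ∈ Finset.range n, dist (T (x (i + k))) (x (i + k + 1)) < δ

/-- Besicovitch pseudo-distance between two sequences. -/
noncomputable def seqBesicovitchDist {X : Type*} [MetricSpace X] (x z : ℕ → X) : ℝ :=
  Filter.limsup
    (fun n : ℕ => (1 / (n : ℝ)) * ∑ j ∈ Finset.range n, dist (x j) (z j)) Filter.atTop

/-- `(X,T)` has the average shadowing property. -/
def AverageShadowing {X : Type*} [MetricSpace X] (T : X → X) : Prop :=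
  ∀ ε > (0 : ℝ), ∃ δ > (0 : ℝ), ∀ x : ℕ → X, IsAvgPseudoOrbit T δ x →
    ∃ z : X, seqBesicovitchDist (fun j => T^[j] z) x < ε

open scoped Topology BoundedContinuousFunction

/-- The minimum of the integral of a continuous function over the invariant probability measures
is attained at an ergodic measure. -/
theorem exists_ergodic_integral_le {X : Type*} [MetricSpace X] [CompactSpace X]
    [MeasurableSpace X] [BorelSpace X] {T : X → X} (hT : Continuous T) (g : C(X, ℝ))
    (ν : ProbabilityMeasure X) (hν : Measure.map T (ν : Measure X) = ν) :
    ∃ e : ProbabilityMeasure X, Ergodic T (e : Measure X) ∧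
      ∫ x, g x ∂(e : Measure X) ≤ ∫ x, g x ∂(ν : Measure X) := by
  let J : ProbabilityMeasure X → (C(X, ℝ) → ℝ) := fun μ f => ∫ x, f x ∂(μ : Measure X)
  have hJ : Continuous J := continuous_pi fun f =>
    ProbabilityMeasure.continuous_integral_continuousMap f
  let S : Set (ProbabilityMeasure X) := {μ | μ.map hT.aemeasurable = μ}
  have hS : ∀ μ : ProbabilityMeasure X, μ ∈ S ↔ Measure.map T (μ : Measure X) = μ := fun μ =>
    ⟨fun h => congrArg (fun m : ProbabilityMeasure X => (m : Measure X)) h,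
      fun h => Subtype.ext h⟩
  have hSc : IsCompact S :=
    (isClosed_eq (ProbabilityMeasure.continuous_map hT) continuous_id).isCompact
  have hK : IsCompact (J '' S) := hSc.image hJ
  let l : StrongDual ℝ (C(X, ℝ) → ℝ) := -(ContinuousLinearMap.proj g)
  have hB : IsExposed ℝ (J '' S) (l.toExposed (J '' S)) :=
    ContinuousLinearMap.toExposed.isExposed
  have hBne : (l.toExposed (J '' S)).Nonempty := by
    obtain ⟨z, hz, hmax⟩ := hK.exists_isMaxOn ⟨J ν, ν, (hS ν).2 hν, rfl⟩
      l.continuous.continuousOn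
    exact ⟨z, hz, hmax⟩
  obtain ⟨x, hx⟩ := (hB.isCompact hK).extremePoints_nonempty hBne
  have hxK := hB.isExtreme.extremePoints_subset_extremePoints hx
  have hxB := hx.1
  obtain ⟨⟨e, heS, rfl⟩, hext⟩ := mem_extremePoints_iff_left.1 hxK
  refine ⟨e, Ergodic.of_mem_extremePoints ?_, ?_⟩
  · rw [mem_extremePoints_iff_left]
    refine ⟨⟨⟨hT.measurable, (hS e).1 heS⟩, inferInstance⟩, ?_⟩
    rintro μ₁ ⟨h₁, p₁⟩ μ₂ ⟨h₂, p₂⟩ ⟨a, b, ha, hb, hab, he⟩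
    have ha' : a ≠ ⊤ := fun h => by simp [h] at hab
    have hb' : b ≠ ⊤ := fun h => by simp [h] at hab
    have key : J ⟨μ₁, p₁⟩ = J e := by
      refine hext _ ⟨⟨μ₁, p₁⟩, (hS _).2 h₁.map_eq, rfl⟩ (J ⟨μ₂, p₂⟩)
        ⟨⟨μ₂, p₂⟩, (hS _).2 h₂.map_eq, rfl⟩ ⟨a.toReal, b.toReal, ENNReal.toReal_pos ha.ne' ha',
          ENNReal.toReal_pos hb.ne' hb', ?_, ?_⟩
      · rw [← ENNReal.toReal_add ha' hb', hab, ENNReal.toReal_one]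
      · funext f
        have hi : ∀ (m : Measure X) [IsProbabilityMeasure m], Integrable f m := fun m _ =>
          f.continuous.integrable_of_hasCompactSupport (HasCompactSupport.of_compactSpace f)
        change a.toReal * ∫ x, f x ∂μ₁ + b.toReal * ∫ x, f x ∂μ₂ = ∫ x, f x ∂(e : Measure X)
        rw [← he, integral_add_measure ((hi μ₁).smul_measure ha') ((hi μ₂).smul_measure hb'),
          integral_smul_measure, integral_smul_measure]
        rfl
    refine ext_of_forall_integral_eq_of_IsFiniteMeasure fun f => ?_
    exact congrFun key f.toContinuousMap
  · have := hxB.2 (J ν) ⟨ν, (hS ν).2 hν, rfl⟩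
    simpa [l, J] using this

/-- The mean of a continuous vector-valued function is approximated by averages over finitely many
points. -/
theorem exists_average_near_integral {X E : Type*} [MetricSpace X] [CompactSpace X]
    [MeasurableSpace X] [BorelSpace X] [NormedAddCommGroup E] [NormedSpace ℝ E] [CompleteSpace E]
    [MeasurableSpace E] [BorelSpace E] (μ : Measure X) [IsProbabilityMeasure μ]
    {f : X → E} (hf : Continuous f) {η : ℝ} (hη : 0 < η) :
    ∃ M : ℕ, 0 < M ∧ ∃ y : ℕ → X, ‖(M : ℝ)⁻¹ • ∑ j ∈ range M, f (y j) - ∫ x, f x ∂μ‖ < η := by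
  have hint : Integrable f μ :=
    hf.integrable_of_hasCompactSupport (HasCompactSupport.of_compactSpace f)
  let P : Measure (ℕ → X) := Measure.infinitePi fun _ => μ
  have hmp : ∀ i, MeasurePreserving (Function.eval i) P μ := fun i =>
    measurePreserving_eval_infinitePi (fun _ => μ) i
  have hindep : ProbabilityTheory.iIndepFun (fun (i : ℕ) (ω : ℕ → X) => f (ω i)) P :=
    ProbabilityTheory.iIndepFun_infinitePi (P := fun _ : ℕ => μ) (X := fun _ => f)
      fun _ => hf.measurable
  have hid : ∀ i, ProbabilityTheory.IdentDistrib (fun ω : ℕ → X => f (ω i))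
      (fun ω => f (ω 0)) P P := fun i =>
    { aemeasurable_fst := (hf.measurable.comp (measurable_pi_apply i)).aemeasurable
      aemeasurable_snd := (hf.measurable.comp (measurable_pi_apply 0)).aemeasurable
      map_eq := by
        have h : ∀ i, Measure.map (fun ω : ℕ → X => f (ω i)) P = Measure.map f μ := fun i => by
          rw [← (hmp i).map_eq, Measure.map_map hf.measurable (hmp i).measurable]
          rfl
        rw [h, h] }
  have hlln := ProbabilityTheory.strong_law_ae (fun (i : ℕ) (ω : ℕ → X) => f (ω i))
    ((hmp 0).integrable_comp_of_integrable hint) (fun i j hij => hindep.indepFun hij) hid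
  obtain ⟨y, hy⟩ := hlln.exists
  have hmean : ∫ ω : ℕ → X, f (ω 0) ∂P = ∫ x, f x ∂μ := by
    rw [← (hmp 0).map_eq, integral_map (hmp 0).measurable.aemeasurable
      hf.aestronglyMeasurable]
  rw [hmean] at hy
  obtain ⟨M, hM, hM0⟩ := ((Metric.tendsto_nhds.1 hy η hη).and (eventually_gt_atTop 0)).exists
  exact ⟨M, hM0, y, by rwa [dist_eq_norm] at hM⟩

/-- Bounds on the time averages of a continuous function along an orbit pass to some invariant
measure. -/
theorem exists_invariant_integral_le {X : Type*} [MetricSpace X] [CompactSpace X]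
    [MeasurableSpace X] [BorelSpace X] {T : X → X} (hT : Continuous T) (g : C(X, ℝ)) (z : X)
    {C : ℝ} (hC : ∀ᶠ n : ℕ in atTop, birkhoffAverage ℝ T g n z ≤ C) :
    ∃ ν : ProbabilityMeasure X, Measure.map T (ν : Measure X) = ν ∧
      ∫ x, g x ∂(ν : Measure X) ≤ C := by
  let m : ℕ → Measure X := fun n =>
    ((n + 1 : ℕ) : ENNReal)⁻¹ • ∑ j ∈ range (n + 1), Measure.dirac (T^[j] z)
  have hm : ∀ n, IsProbabilityMeasure (m n) := fun n => ⟨by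
    simp only [m, Measure.smul_apply, Measure.finsetSum_apply, measure_univ, sum_const,
      card_range, nsmul_eq_mul, mul_one, smul_eq_mul]
    exact ENNReal.inv_mul_cancel (by simp) (ENNReal.natCast_ne_top _)⟩
  have hint : ∀ (f : X → ℝ), Continuous f → ∀ n,
      ∫ x, f x ∂(m n) = birkhoffAverage ℝ T f (n + 1) z := fun f hf n => by
    have hi : ∀ x, Integrable f (Measure.dirac x) := fun x =>
      hf.integrable_of_hasCompactSupport (HasCompactSupport.of_compactSpace f)
    simp only [m, integral_smul_measure, integral_finsetSum_measure fun i _ => hi _,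
      integral_dirac, birkhoffAverage, birkhoffSum, ENNReal.toReal_inv, ENNReal.toReal_natCast]
  let u : ℕ → ProbabilityMeasure X := fun n => ⟨m n, hm n⟩
  obtain ⟨ν, -, hν⟩ := isCompact_univ (X := ProbabilityMeasure X).ultrafilter_le_nhds
    ((Ultrafilter.of (atTop : Filter ℕ)).map u) (by simp)
  have hlim : ∀ f : C(X, ℝ), Tendsto (fun n => birkhoffAverage ℝ T f (n + 1) z)
      (Ultrafilter.of (atTop : Filter ℕ)) (𝓝 (∫ x, f x ∂(ν : Measure X))) := fun f => by
    have := ((ProbabilityMeasure.continuous_integral_continuousMap f).tendsto ν).comp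
      (show Tendsto u (Ultrafilter.of (atTop : Filter ℕ)) (𝓝 ν) from hν)
    refine this.congr fun n => hint f f.continuous n
  have hU : (Ultrafilter.of (atTop : Filter ℕ) : Filter ℕ) ≤ atTop := Ultrafilter.of_le _
  refine ⟨ν, ?_, le_of_tendsto (hlim g)
    (hU ((tendsto_add_atTop_nat 1).eventually hC))⟩
  have hp : IsProbabilityMeasure (Measure.map T (ν : Measure X)) :=
    Measure.isProbabilityMeasure_map hT.aemeasurable
  refine ext_of_forall_integral_eq_of_IsFiniteMeasure fun f => ?_
  rw [integral_map hT.aemeasurable f.continuous.aestronglyMeasurable]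
  refine tendsto_nhds_unique
    (hlim (f.toContinuousMap.comp ⟨T, hT⟩)) ?_
  have h0 : Tendsto (fun n => birkhoffAverage ℝ T f (n + 1) (T z) -
      birkhoffAverage ℝ T f (n + 1) z) (Ultrafilter.of (atTop : Filter ℕ)) (𝓝 0) :=
    ((tendsto_birkhoffAverage_apply_sub_birkhoffAverage ℝ
      (f.isBounded_range.subset (Set.range_comp_subset_range _ f))).comp
      (tendsto_add_atTop_nat 1)).mono_left hU
  have := h0.add (hlim f.toContinuousMap)
  rw [zero_add] at this
  refine this.congr fun n => ?_
  simp [birkhoffAverage, birkhoffSum, ← Function.iterate_succ_apply,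
    Function.iterate_succ_apply']

theorem sum_range_mul_eq_sum_sum {E : Type*} [AddCommMonoid E] (a : ℕ → E) (M L : ℕ) :
    ∑ i ∈ range (M * L), a i = ∑ j ∈ range M, ∑ r ∈ range L, a (j * L + r) := by
  induction M with
  | zero => simp
  | succ M ih => rw [Nat.succ_mul, sum_range_add, ih, sum_range_succ]

theorem Function.Periodic.sum_range_add_eq {E : Type*} [AddCommGroup E] {a : ℕ → E} {P : ℕ}
    (ha : Function.Periodic a P) (k : ℕ) :
    ∑ i ∈ range P, a (k + i) = ∑ i ∈ range P, a i := by
  induction k with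
  | zero => simp
  | succ k ih =>
    have h := sum_range_succ' (fun i => a (k + i)) P
    rw [sum_range_succ, ih, ha k, add_zero, add_right_cancel_iff] at h
    rw [h]
    exact sum_congr rfl fun i _ => by rw [add_right_comm, add_assoc]

/-- The periodic concatenation of the orbit segments of length `L` of the points
`y 0, …, y (M - 1)`. -/
def segmentOrbit {X : Type*} (T : X → X) (y : ℕ → X) (M L : ℕ) (i : ℕ) : X :=
  T^[i % L] (y (i / L % M))

theorem segmentOrbit_periodic {X : Type*} (T : X → X) (y : ℕ → X) (M : ℕ) {L : ℕ} (hL : 0 < L) :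
    Function.Periodic (segmentOrbit T y M L) (M * L) := fun i => by
  simp [segmentOrbit, Nat.add_mul_div_right _ _ hL]

theorem sum_segmentOrbit {X E : Type*} [AddCommGroup E] (T : X → X) (y : ℕ → X) (M : ℕ) {L : ℕ}
    (hL : 0 < L) (F : X → E) :
    ∑ i ∈ range (M * L), F (segmentOrbit T y M L i) = ∑ j ∈ range M, birkhoffSum T F L (y j) := by
  rw [sum_range_mul_eq_sum_sum]
  refine sum_congr rfl fun j hj => sum_congr rfl fun r hr => ?_
  rw [mem_range] at hj hr
  have h1 : (j * L + r) / L = j := by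
    rw [add_comm, Nat.add_mul_div_right _ _ hL, Nat.div_eq_of_lt hr, zero_add]
  have h2 : (j * L + r) % L = r := by
    rw [add_comm, Nat.add_mul_mod_self_right, Nat.mod_eq_of_lt hr]
  rw [segmentOrbit, h1, h2, Nat.mod_eq_of_lt hj]

theorem dist_segmentOrbit_succ_le {X : Type*} [MetricSpace X] (hX : ∀ a b : X, dist a b ≤ 1)
    (T : X → X) (y : ℕ → X) (M L : ℕ) (i : ℕ) :
    dist (T (segmentOrbit T y M L i)) (segmentOrbit T y M L (i + 1)) ≤
      (((i + 1) / L : ℕ) : ℝ) - ((i / L : ℕ) : ℝ) := by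
  rw [Nat.succ_div]
  split_ifs with h
  · push_cast
    linarith [hX (T (segmentOrbit T y M L i)) (segmentOrbit T y M L (i + 1))]
  · have h2 : (i + 1) / L = i / L := by rw [Nat.succ_div, if_neg h, add_zero]
    have h1 : (i + 1) % L = i % L + 1 := by
      have h3 := Nat.div_add_mod (i + 1) L
      have h4 := Nat.div_add_mod i L
      rw [h2] at h3
      omega
    rw [segmentOrbit, segmentOrbit, h1, h2, Function.iterate_succ_apply']
    simp

/-- Concatenations of long orbit segments are average pseudo-orbits. -/
theorem isAvgPseudoOrbit_segmentOrbit {X : Type*} [MetricSpace X] (hX : ∀ a b : X, dist a b ≤ 1)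
    (T : X → X) (y : ℕ → X) (M : ℕ) {L : ℕ} (hL : 0 < L) {δ : ℝ} (hδ : 2 / δ < L) (hδ0 : 0 < δ) :
    IsAvgPseudoOrbit T δ (segmentOrbit T y M L) := by
  refine ⟨L, fun n hn k => ?_⟩
  have hn0 : (0 : ℝ) < n := by exact_mod_cast hL.trans_le hn
  have hL0 : (0 : ℝ) < L := by exact_mod_cast hL
  have hLn : (L : ℝ) ≤ n := by exact_mod_cast hn
  have hsum : ∑ i ∈ range n, dist (T (segmentOrbit T y M L (i + k)))
      (segmentOrbit T y M L (i + k + 1)) ≤ (((n + k) / L : ℕ) : ℝ) - ((k / L : ℕ) : ℝ) := by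
    have h := sum_range_sub (fun i => (((i + k) / L : ℕ) : ℝ)) n
    simp only [zero_add] at h
    rw [← h]
    refine sum_le_sum fun i _ => ?_
    rw [add_right_comm i 1 k]
    exact dist_segmentOrbit_succ_le hX T y M L (i + k)
  have h1 : (((n + k) / L : ℕ) : ℝ) ≤ (n + k) / L := by
    simpa using Nat.cast_div_le (α := ℝ) (m := n + k) (n := L)
  have h2 : (k : ℝ) / L ≤ ((k / L : ℕ) : ℝ) + 1 := by
    rw [div_le_iff₀ hL0, mul_comm]
    exact_mod_cast (Nat.lt_mul_div_succ k hL).le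
  have h3 : (2 : ℝ) < δ * L := by rwa [div_lt_iff₀' hδ0] at hδ
  rw [one_div, inv_mul_lt_iff₀ hn0]
  refine hsum.trans_lt ?_
  have h4 : (n : ℝ) / L + 1 < n * δ := by
    rw [div_add_one hL0.ne', div_lt_iff₀ hL0]
    nlinarith
  rw [add_div] at h1
  linarith

theorem exists_norm_sub_le_add_mul_dist {X E : Type*} [MetricSpace X] [CompactSpace X]
    [NormedAddCommGroup E] {F : X → E} (hF : Continuous F) {η : ℝ} (hη : 0 < η) :
    ∃ C : ℝ, 0 ≤ C ∧ ∀ a b, ‖F a - F b‖ ≤ η + C * dist a b := by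
  obtain ⟨r, hr, hFr⟩ := Metric.uniformContinuous_iff.1
    (CompactSpace.uniformContinuous_of_continuous hF) η hη
  obtain ⟨B, hB⟩ := (isCompact_range hF).isBounded.exists_norm_le
  have hB' : ∀ a, ‖F a‖ ≤ max B 0 := fun a => (hB _ ⟨a, rfl⟩).trans (le_max_left _ _)
  refine ⟨2 * max B 0 / r, by positivity, fun a b => ?_⟩
  rcases lt_or_ge (dist a b) r with h | h
  · have := hFr h
    rw [dist_eq_norm] at this
    have h' : 0 ≤ 2 * max B 0 / r * dist a b := by positivity
    linarith
  · have h' : 2 * max B 0 ≤ 2 * max B 0 / r * dist a b := by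
      rw [div_mul_eq_mul_div, le_div_iff₀ hr]
      exact mul_le_mul_of_nonneg_left h (by positivity)
    linarith [norm_sub_le (F a) (F b), hB' a, hB' b]

theorem integral_birkhoffAverage {X E : Type*} [MeasurableSpace X] [NormedAddCommGroup E]
    [NormedSpace ℝ E] {T : X → X} {μ : Measure X} (hT : MeasurePreserving T μ μ) {F : X → E}
    (hF : Integrable F μ) {P : ℕ} (hP : 0 < P) :
    ∫ x, birkhoffAverage ℝ T F P x ∂μ = ∫ x, F x ∂μ := by
  have h : ∀ k, ∫ x, F (T^[k] x) ∂μ = ∫ x, F x ∂μ := fun k => by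
    have hk := (hT.iterate k)
    rw [← integral_map hk.measurable.aemeasurable (by rw [hk.map_eq]; exact hF.1), hk.map_eq]
  simp only [birkhoffAverage, birkhoffSum]
  rw [integral_smul, integral_finsetSum (f := fun k x => F (T^[k] x)) _
    fun k _ => (hT.iterate k).integrable_comp_of_integrable hF]
  simp only [h, sum_const, card_range]
  rw [← Nat.cast_smul_eq_nsmul ℝ, smul_smul, inv_mul_cancel₀ (by positivity), one_smul]

theorem continuous_birkhoffAverage {X E : Type*} [TopologicalSpace X] [NormedAddCommGroup E]
    [NormedSpace ℝ E] {T : X → X} (hT : Continuous T) {F : X → E} (hF : Continuous F) (P : ℕ) :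
    Continuous (birkhoffAverage ℝ T F P) :=
  continuous_const.smul (continuous_finsetSum _ fun k _ => hF.comp (hT.iterate k))

/-- If an orbit is close on average to a sequence all of whose windows of length `P` average to a
vector near `c`, then most window averages along the orbit are near `c`. -/
theorem sum_norm_birkhoffAverage_sub_le {X E : Type*} [MetricSpace X] [NormedAddCommGroup E]
    [NormedSpace ℝ E] (hX : ∀ a b : X, dist a b ≤ 1) {T : X → X} {F : X → E} {η C : ℝ}
    (hC : 0 ≤ C) (hFC : ∀ a b, ‖F a - F b‖ ≤ η + C * dist a b) {x : ℕ → X} {P : ℕ} (hP : 0 < P)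
    {c : E} (hx : ∀ k, ‖(P : ℝ)⁻¹ • ∑ i ∈ range P, F (x (k + i)) - c‖ ≤ η) (z : X) (n : ℕ) :
    ∑ j ∈ range n, ‖birkhoffAverage ℝ T F P (T^[j] z) - c‖ ≤
      n * (2 * η) + C * (∑ j ∈ range n, dist (T^[j] z) (x j) + P) := by
  have hP0 : (0 : ℝ) < P := by exact_mod_cast hP
  have hwin : ∀ j, ‖birkhoffAverage ℝ T F P (T^[j] z) - c‖ ≤
      2 * η + C * ((P : ℝ)⁻¹ * ∑ i ∈ range P, dist (T^[j + i] z) (x (j + i))) := fun j => by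
    have h1 : birkhoffAverage ℝ T F P (T^[j] z) - c =
        (P : ℝ)⁻¹ • ∑ i ∈ range P, (F (T^[j + i] z) - F (x (j + i))) +
          ((P : ℝ)⁻¹ • ∑ i ∈ range P, F (x (j + i)) - c) := by
      rw [sum_sub_distrib, smul_sub, birkhoffAverage, birkhoffSum]
      simp only [← Function.iterate_add_apply, add_comm _ j]
      abel
    have h2 : ‖(P : ℝ)⁻¹ • ∑ i ∈ range P, (F (T^[j + i] z) - F (x (j + i)))‖ ≤
        η + C * ((P : ℝ)⁻¹ * ∑ i ∈ range P, dist (T^[j + i] z) (x (j + i))) := by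
      rw [norm_smul, norm_inv, Real.norm_of_nonneg hP0.le, inv_mul_le_iff₀ hP0]
      refine (norm_sum_le_of_le _ fun i _ => hFC _ _).trans (le_of_eq ?_)
      rw [sum_add_distrib, ← mul_sum]
      simp only [sum_const, card_range, nsmul_eq_mul]
      field_simp
    rw [h1]
    linarith [norm_add_le ((P : ℝ)⁻¹ • ∑ i ∈ range P, (F (T^[j + i] z) - F (x (j + i))))
      ((P : ℝ)⁻¹ • ∑ i ∈ range P, F (x (j + i)) - c), hx j]
  have hshift : ∀ i ∈ range P, ∑ j ∈ range n, dist (T^[j + i] z) (x (j + i)) ≤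
      ∑ j ∈ range n, dist (T^[j] z) (x j) + P := fun i hi => by
    have h1 : ∑ j ∈ range n, dist (T^[j + i] z) (x (j + i)) ≤
        ∑ j ∈ range (n + i), dist (T^[j] z) (x j) := by
      rw [add_comm n i, sum_range_add]
      simp only [add_comm i]
      exact le_add_of_nonneg_left (sum_nonneg fun _ _ => dist_nonneg)
    have h2 : ∑ j ∈ range i, dist (T^[n + j] z) (x (n + j)) ≤ i := by
      simpa using sum_le_card_nsmul (range i) _ 1 fun j _ => hX (T^[n + j] z) (x (n + j))
    have h3 : (i : ℝ) ≤ P := by exact_mod_cast (mem_range.1 hi).le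
    rw [sum_range_add] at h1
    linarith
  calc ∑ j ∈ range n, ‖birkhoffAverage ℝ T F P (T^[j] z) - c‖
      ≤ ∑ j ∈ range n,
          (2 * η + C * ((P : ℝ)⁻¹ * ∑ i ∈ range P, dist (T^[j + i] z) (x (j + i)))) :=
        sum_le_sum fun j _ => hwin j
    _ = n * (2 * η) +
          C * ((P : ℝ)⁻¹ * ∑ i ∈ range P, ∑ j ∈ range n, dist (T^[j + i] z) (x (j + i))) := by
        rw [sum_comm (s := range P), sum_add_distrib, sum_const, card_range, nsmul_eq_mul,
          ← mul_sum, ← mul_sum]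
    _ ≤ _ := by
        gcongr
        rw [inv_mul_le_iff₀ hP0]
        exact (sum_le_card_nsmul (range P) _ _ hshift).trans_eq (by simp [mul_add])

theorem eventually_average_lt_of_seqBesicovitchDist_lt {X : Type*} [MetricSpace X]
    (hX : ∀ a b : X, dist a b ≤ 1) {x z : ℕ → X} {ε : ℝ} (h : seqBesicovitchDist x z < ε) :
    ∀ᶠ n : ℕ in atTop, (1 / (n : ℝ)) * ∑ j ∈ range n, dist (x j) (z j) < ε := by
  refine eventually_lt_of_limsup_lt h ⟨1, eventually_map.2 (Eventually.of_forall fun n => ?_)⟩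
  rw [one_div]
  refine inv_mul_le_one_of_le₀ ?_ n.cast_nonneg
  simpa using sum_le_card_nsmul (range n) _ 1 fun j _ => hX (x j) (z j)

/-- In a system with the average shadowing property, the integral of a vector-valued continuous
function against an invariant measure is approximated by its integral against an ergodic one. -/
theorem AverageShadowing.exists_ergodic_norm_integral_sub_le {X E : Type*} [MetricSpace X]
    [CompactSpace X] [MeasurableSpace X] [BorelSpace X] [NormedAddCommGroup E] [NormedSpace ℝ E]
    [CompleteSpace E] [MeasurableSpace E] [BorelSpace E] {T : X → X} (hasp : AverageShadowing T)
    (hX : ∀ a b : X, dist a b ≤ 1) (hT : Continuous T) {F : X → E} (hF : Continuous F)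
    (μ : Measure X) [IsProbabilityMeasure μ] (hμ : MeasurePreserving T μ μ) {η : ℝ}
    (hη : 0 < η) :
    ∃ e : ProbabilityMeasure X, Ergodic T (e : Measure X) ∧
      ‖∫ x, F x ∂(e : Measure X) - ∫ x, F x ∂μ‖ ≤ 4 * η := by
  have hi : ∀ (G : X → E) (m : Measure X) [IsProbabilityMeasure m], Continuous G →
      Integrable G m := fun G m _ hG =>
    hG.integrable_of_hasCompactSupport (HasCompactSupport.of_compactSpace G)
  set c := ∫ x, F x ∂μ with hc
  obtain ⟨C, hC, hFC⟩ := exists_norm_sub_le_add_mul_dist hF hη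
  obtain ⟨ε, hε, hCε⟩ : ∃ ε > 0, C * ε ≤ η :=
    ⟨η / (C + 1), by positivity, by
      rw [mul_div_assoc', div_le_iff₀ (by positivity)]
      nlinarith⟩
  obtain ⟨δ, hδ, hsh⟩ := hasp ε hε
  obtain ⟨L, hL⟩ := exists_nat_gt (2 / δ)
  have hL0 : 0 < L := by
    have : (0 : ℝ) < L := lt_trans (by positivity) hL
    exact_mod_cast this
  obtain ⟨M, hM, y, hy⟩ :=
    exists_average_near_integral μ (continuous_birkhoffAverage hT hF L) hη
  rw [integral_birkhoffAverage hμ (hi F μ hF) hL0, ← hc] at hy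
  set x := segmentOrbit T y M L with hxdef
  obtain ⟨z, hz⟩ := hsh x (isAvgPseudoOrbit_segmentOrbit hX T y M hL0 hL hδ)
  have hP : 0 < M * L := Nat.mul_pos hM hL0
  have hwin : ∀ k, ‖((M * L : ℕ) : ℝ)⁻¹ • ∑ i ∈ range (M * L), F (x (k + i)) - c‖ ≤ η :=
    fun k => by
      have hper : Function.Periodic (fun i => F (x i)) (M * L) := fun i =>
        congrArg F (segmentOrbit_periodic T y M hL0 i)
      rw [hper.sum_range_add_eq k, hxdef, sum_segmentOrbit T y M hL0 F, Nat.cast_mul, mul_inv,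
        mul_smul, smul_sum]
      exact hy.le
  have hA := continuous_birkhoffAverage hT hF (M * L)
  let g : C(X, ℝ) := ⟨fun w => ‖birkhoffAverage ℝ T F (M * L) w - c‖,
    (hA.sub continuous_const).norm⟩
  have hg : ∀ᶠ n : ℕ in atTop, birkhoffAverage ℝ T g n z ≤ 4 * η := by
    have hlarge : ∀ᶠ n : ℕ in atTop, ((M * L : ℕ) : ℝ) / ε ≤ n :=
      tendsto_natCast_atTop_atTop.eventually_ge_atTop _
    filter_upwards [eventually_average_lt_of_seqBesicovitchDist_lt hX hz, hlarge,
      eventually_gt_atTop 0] with n h1 h2 hn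
    have hn0 : (0 : ℝ) < n := by exact_mod_cast hn
    have h3 := sum_norm_birkhoffAverage_sub_le (T := T) hX hC hFC hP hwin z n
    rw [one_div, inv_mul_lt_iff₀ hn0] at h1
    rw [div_le_iff₀ hε] at h2
    rw [birkhoffAverage, birkhoffSum, smul_eq_mul, inv_mul_le_iff₀ hn0]
    refine h3.trans ?_
    have h4 : C * (∑ j ∈ range n, dist (T^[j] z) (x j) + ((M * L : ℕ) : ℝ)) ≤
        C * (n * ε + n * ε) := by gcongr
    nlinarith
  obtain ⟨ν, hν, hνg⟩ := exists_invariant_integral_le hT g z hg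
  obtain ⟨e, he, heg⟩ := exists_ergodic_integral_le hT g ν hν
  refine ⟨e, he, ?_⟩
  rw [← integral_birkhoffAverage he.toMeasurePreserving (hi F e hF) hP]
  calc ‖∫ w, birkhoffAverage ℝ T F (M * L) w ∂(e : Measure X) - c‖
      = ‖∫ w, (birkhoffAverage ℝ T F (M * L) w - c) ∂(e : Measure X)‖ := by
        rw [integral_sub (hi _ e hA) (integrable_const c), integral_const]
        simp
    _ ≤ ∫ w, g w ∂(e : Measure X) := norm_integral_le_integral_norm _
    _ ≤ 4 * η := heg.trans hνg

/-- For a surjective system with the average shadowing property, the ergodic measures are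
dense in the space of `T`-invariant Borel probability measures (with the weak* topology,
realized as the subspace topology inherited from `ProbabilityMeasure X`). -/
theorem stmt9 {X : Type*} [MetricSpace X] [CompactSpace X] [MeasurableSpace X] [BorelSpace X]
    (hdiam : Metric.diam (Set.univ : Set X) ≤ 1)
    (T : X → X) (hT : Continuous T) (hsurj : Function.Surjective T)
    (hasp : AverageShadowing T) :
    Dense {μ : {ν : ProbabilityMeasure X //
        Measure.map T (ν : Measure X) = (ν : Measure X)} |
      Ergodic T ((μ : ProbabilityMeasure X) : Measure X)} := by
  have hX : ∀ a b : X, dist a b ≤ 1 := fun a b =>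
    (Metric.dist_le_diam_of_mem isCompact_univ.isBounded (Set.mem_univ a)
      (Set.mem_univ b)).trans hdiam
  rintro ⟨μ, hμ⟩
  have key : ∀ p : Finset (X →ᵇ ℝ) × ℕ, ∃ e : ProbabilityMeasure X,
      Ergodic T (e : Measure X) ∧ ∀ φ ∈ p.1,
        |∫ x, φ x ∂(e : Measure X) - ∫ x, φ x ∂(μ : Measure X)| ≤ 1 / ((p.2 : ℝ) + 1) := by
    rintro ⟨s, n⟩
    let F : X → (s → ℝ) := fun x φ => φ.1 x
    have hF : Continuous F := continuous_pi fun φ => φ.1.continuous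
    obtain ⟨e, he, hle⟩ := hasp.exists_ergodic_norm_integral_sub_le hX hT hF (μ : Measure X)
      ⟨hT.measurable, hμ⟩ (show 0 < 1 / ((n : ℝ) + 1) / 4 by positivity)
    refine ⟨e, he, fun φ hφ => ?_⟩
    have h := (norm_le_pi_norm _ (⟨φ, hφ⟩ : s)).trans hle
    rw [Pi.sub_apply, eval_integral fun ψ => ψ.1.integrable _,
      eval_integral fun ψ => ψ.1.integrable _, Real.norm_eq_abs] at h
    exact h.trans (by linarith)
  choose e he hle using key
  refine mem_closure_of_tendsto (b := (atTop : Filter (Finset (X →ᵇ ℝ) × ℕ)))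
    (f := fun p => ⟨e p, (he p).toMeasurePreserving.map_eq⟩) ?_ (Eventually.of_forall he)
  rw [tendsto_subtype_rng, ProbabilityMeasure.tendsto_iff_forall_integral_tendsto]
  intro φ
  rw [← prod_atTop_atTop_eq, tendsto_iff_dist_tendsto_zero]
  refine squeeze_zero' (Eventually.of_forall fun _ => dist_nonneg) ?_
    (tendsto_one_div_add_atTop_nhds_zero_nat.comp tendsto_snd)
  filter_upwards [tendsto_fst.eventually (eventually_ge_atTop {φ})] with p hp
  exact hle p φ (hp (mem_singleton_self φ))
end

section
/- There exists a topological dynamical system (X,T) on a compact metric space X that is not Besicovitch complete; that is, there is a Besicovitch-Cauchy sequence (z^{(n)})_{n=0}^∞ in X for which no point z ∈ X satisfies lim_{n→∞} ρ_B^T(z^{(n)}, z) = 0. -/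
open Filter Finset
open scoped Classical

/-- The dynamical Besicovitch pseudo-metric:
`ρ_B^T(x,y) = limsup_{n→∞} (1/n) ∑_{j=0}^{n-1} ρ(T^j(x), T^j(y))`. -/
noncomputable def rhoBT {X : Type*} [MetricSpace X] (T : X → X) (x y : X) : ℝ :=
  Filter.limsup
    (fun n : ℕ => (1 / (n : ℝ)) * ∑ j ∈ Finset.range n, dist (T^[j] x) (T^[j] y)) Filter.atTop

/-- A sequence `(z^{(n)})` in `X` is Besicovitch-Cauchy. -/
def BesicovitchCauchy {X : Type*} [MetricSpace X] (T : X → X) (z : ℕ → X) : Prop :=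
  ∀ ε > (0 : ℝ), ∃ N : ℕ, ∀ n m : ℕ, N ≤ n → N ≤ m → rhoBT T (z n) (z m) < ε

theorem le_rhoBT_of_frequently {X : Type*} [MetricSpace X] [CompactSpace X] {T : X → X} {x y : X}
    {b : ℝ} (h : ∃ᶠ n : ℕ in atTop,
      b ≤ (1 / (n : ℝ)) * ∑ j ∈ Finset.range n, dist (T^[j] x) (T^[j] y)) :
    b ≤ rhoBT T x y := by
  refine le_limsup_of_frequently_le h ?_
  refine isBoundedUnder_of ⟨Metric.diam (Set.univ : Set X), fun n => ?_⟩
  have hsum : ∑ j ∈ Finset.range n, dist (T^[j] x) (T^[j] y)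
      ≤ n * Metric.diam (Set.univ : Set X) := by
    have := Finset.sum_le_card_nsmul (Finset.range n) (fun j => dist (T^[j] x) (T^[j] y))
      (Metric.diam (Set.univ : Set X)) fun j _ =>
        Metric.dist_le_diam_of_mem isCompact_univ.isBounded (Set.mem_univ _) (Set.mem_univ _)
    simpa using this
  rcases Nat.eq_zero_or_pos n with rfl | hn
  · simpa using Metric.diam_nonneg
  · have hn' : (0 : ℝ) < n := by exact_mod_cast hn
    rw [one_div, inv_mul_le_iff₀ hn']
    exact hsum

theorem le_rhoBT_of_forall_le {X : Type*} [MetricSpace X] [CompactSpace X] {T : X → X} {x y : X}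
    {b : ℝ} (h : ∀ j, b ≤ dist (T^[j] x) (T^[j] y)) : b ≤ rhoBT T x y := by
  refine le_rhoBT_of_frequently (Eventually.frequently ?_)
  filter_upwards [eventually_gt_atTop 0] with n hn
  have hn' : (0 : ℝ) < n := by exact_mod_cast hn
  rw [one_div, le_inv_mul_iff₀ hn']
  simpa using Finset.card_nsmul_le_sum (Finset.range n)
    (fun j => dist (T^[j] x) (T^[j] y)) b fun j _ => h j

theorem rhoBT_eq_of_tendsto_dist {X : Type*} [MetricSpace X] {T : X → X} {x y : X} {l : ℝ}
    (h : Tendsto (fun j => dist (T^[j] x) (T^[j] y)) atTop (nhds l)) : rhoBT T x y = l := by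
  have := h.cesaro
  simp only [← one_div] at this
  exact this.limsup_eq

namespace SlowRotation

/-- Triples `(a, r, w)`: the parameter `a` is fixed by the dynamics, `r ≤ a` governs the speed of
rotation, and `w` is the point of the unit disc being rotated. -/
def carrier : Set (ℝ × ℝ × ℂ) := {p | 0 ≤ p.2.1 ∧ p.2.1 ≤ p.1 ∧ p.1 ≤ 1 ∧ ‖p.2.2‖ ≤ 1}

theorem isCompact_carrier : IsCompact carrier := by
  have hK : IsCompact (Set.Icc (0 : ℝ) 1 ×ˢ Set.Icc (0 : ℝ) 1 ×ˢ Metric.closedBall (0 : ℂ) 1) :=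
    isCompact_Icc.prod (isCompact_Icc.prod (isCompact_closedBall _ _))
  refine hK.of_isClosed_subset ?_ ?_
  · simp only [carrier, Set.ofPred_and]
    refine IsClosed.inter ?_ (IsClosed.inter ?_ (IsClosed.inter ?_ ?_)) <;>
      exact isClosed_le (by fun_prop) (by fun_prop)
  · rintro ⟨a, r, w⟩ ⟨h1, h2, h3, h4⟩
    simp only at h1 h2 h3 h4
    simp only [Set.mem_prod, Set.mem_Icc, mem_closedBall_zero_iff]
    exact ⟨⟨h1.trans h2, h3⟩, ⟨h1, h2.trans h3⟩, h4⟩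

/-- The map `(a, r, w) ↦ (a, r / (1 + r), w * (1 + r) ^ I)`. -/
noncomputable def step (p : carrier) : carrier :=
  ⟨(p.1.1, p.1.2.1 / (1 + p.1.2.1),
      p.1.2.2 * Complex.exp ((Real.log (1 + p.1.2.1) : ℝ) * Complex.I)), by
    obtain ⟨⟨a, r, w⟩, h1, h2, h3, h4⟩ := p
    simp only at h1 h2 h3 h4
    refine ⟨by positivity, (div_le_self h1 (by linarith)).trans h2, h3, ?_⟩
    simpa only [norm_mul, Complex.norm_exp_ofReal_mul_I, mul_one] using h4⟩

theorem continuous_step : Continuous step := by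
  have hpos : ∀ p : carrier, 1 + p.1.2.1 ≠ 0 := fun p => by
    have := p.2.1
    positivity
  have hr : Continuous fun p : carrier => 1 + p.1.2.1 := by fun_prop
  have hlog : Continuous fun p : carrier => Real.log (1 + p.1.2.1) := hr.log hpos
  have hdiv : Continuous fun p : carrier => p.1.2.1 / (1 + p.1.2.1) :=
    Continuous.div (by fun_prop) hr hpos
  unfold step
  fun_prop

/-- The points `k ^ I` of the unit circle, for `k = 1, 2, …`. -/
noncomputable def spiral (k : ℕ) : ℂ := Complex.exp ((Real.log (k + 1) : ℝ) * Complex.I)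

theorem spiral_two_mul_add_one (k : ℕ) :
    spiral (2 * k + 1) = spiral k * Complex.exp ((Real.log 2 : ℝ) * Complex.I) := by
  have : Real.log ((2 * k + 1 : ℕ) + 1) = Real.log (k + 1) + Real.log 2 := by
    rw [← Real.log_mul (by positivity) (by norm_num)]
    push_cast
    ring_nf
  rw [spiral, spiral, this, ← Complex.exp_add]
  push_cast
  ring_nf

theorem spiral_succ (k : ℕ) :
    spiral (k + 1) = spiral k * Complex.exp ((Real.log (1 + 1 / (k + 1)) : ℝ) * Complex.I) := by
  have : Real.log ((k + 1 : ℕ) + 1) = Real.log (k + 1) + Real.log (1 + 1 / (k + 1)) := by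
    rw [← Real.log_mul (by positivity) (by positivity)]
    congr 1
    push_cast
    field_simp
  rw [spiral, spiral, this, ← Complex.exp_add]
  push_cast
  ring_nf

theorem norm_spiral (k : ℕ) : ‖spiral k‖ = 1 := Complex.norm_exp_ofReal_mul_I _

theorem tendsto_dist_spiral_succ :
    Tendsto (fun k => dist (spiral (k + 1)) (spiral k)) atTop (nhds 0) := by
  have h1 : Tendsto (fun k : ℕ => (1 + 1 / ((k : ℝ) + 1))) atTop (nhds 1) := by
    simpa using tendsto_one_div_add_atTop_nhds_zero_nat (𝕜 := ℝ).const_add 1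
  have h2 := h1.log one_ne_zero
  rw [Real.log_one] at h2
  have hc : Continuous fun x : ℝ => ‖Complex.exp ((x : ℂ) * Complex.I) - 1‖ := by fun_prop
  have h3 := (hc.tendsto 0).comp h2
  simp only [Complex.ofReal_zero, zero_mul, Complex.exp_zero, sub_self, norm_zero] at h3
  refine h3.congr fun k => ?_
  rw [dist_eq_norm, spiral_succ, ← mul_sub_one, norm_mul, norm_spiral, one_mul]
  rfl

theorem tendsto_dist_spiral_add (n : ℕ) :
    Tendsto (fun k => dist (spiral (n + k)) (spiral k)) atTop (nhds 0) := by
  induction n with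
  | zero => simp
  | succ n ih =>
    have h := (tendsto_dist_spiral_succ.comp (tendsto_add_atTop_nat n)).add ih
    rw [add_zero] at h
    refine squeeze_zero (fun _ => dist_nonneg) (fun k => ?_) h
    have := dist_triangle (spiral (n + k + 1)) (spiral (n + k)) (spiral k)
    simpa [Function.comp_def, add_comm, add_left_comm, add_assoc] using this

/-- A Besicovitch-Cauchy sequence for `step`. -/
noncomputable def base (n : ℕ) : carrier :=
  ⟨(1 / ((n : ℝ) + 1), 1 / ((n : ℝ) + 1), spiral n), by positivity, le_rfl, by
    rw [div_le_one (by positivity)]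
    simp, (norm_spiral n).le⟩

theorem coe_iterate_step_base (n j : ℕ) :
    (step^[j] (base n)).1 = (1 / ((n : ℝ) + 1), 1 / (((n + j : ℕ) : ℝ) + 1), spiral (n + j)) := by
  induction j with
  | zero => rfl
  | succ j ih =>
    rw [Function.iterate_succ_apply', step]
    simp only [ih]
    refine Prod.ext rfl (Prod.ext ?_ (spiral_succ (n + j)).symm)
    push_cast
    field_simp
    ring

theorem rhoBT_base (n m : ℕ) :
    rhoBT step (base n) (base m) = dist (1 / ((n : ℝ) + 1)) (1 / ((m : ℝ) + 1)) := by
  refine rhoBT_eq_of_tendsto_dist ?_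
  simp only [Subtype.dist_eq, coe_iterate_step_base, Prod.dist_eq]
  have hr (n : ℕ) : Tendsto (fun j : ℕ => 1 / (((n + j : ℕ) : ℝ) + 1)) atTop (nhds 0) := by
    simpa only [add_comm n, Function.comp_def] using
      (tendsto_one_div_add_atTop_nhds_zero_nat (𝕜 := ℝ)).comp (tendsto_add_atTop_nat n)
  have h1 := (hr n).dist (hr m)
  have h2 : Tendsto (fun j => dist (spiral (n + j)) (spiral (m + j))) atTop (nhds 0) := by
    have h := (tendsto_dist_spiral_add n).add (tendsto_dist_spiral_add m)
    rw [add_zero] at h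
    exact squeeze_zero (fun _ => dist_nonneg) (fun j => dist_triangle_right _ _ _) h
  have h3 := (tendsto_const_nhds (x := dist (1 / ((n : ℝ) + 1)) (1 / ((m : ℝ) + 1)))).max
    (h1.max h2)
  simpa using h3

theorem besicovitchCauchy_base : BesicovitchCauchy step base := by
  intro ε hε
  simp only [rhoBT_base]
  have h := (tendsto_one_div_add_atTop_nhds_zero_nat (𝕜 := ℝ)).cauchySeq
  obtain ⟨N, hN⟩ := Metric.cauchySeq_iff.1 h ε hε
  exact ⟨N, fun n m hn hm => hN n hn m hm⟩

theorem sum_dist_spiral_ge (c : ℂ) (m M : ℕ) :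
    M * dist (Complex.exp ((Real.log 2 : ℝ) * Complex.I)) 1
      ≤ 2 * ∑ j ∈ Finset.range (2 * M + m), dist (spiral (m + j)) c := by
  set D := dist (Complex.exp ((Real.log 2 : ℝ) * Complex.I)) 1 with hD
  have hpair (j : ℕ) :
      D ≤ dist (spiral (m + j)) c + dist (spiral (m + (2 * j + m + 1))) c := by
    have h : dist (spiral (m + (2 * j + m + 1))) (spiral (m + j)) = D := by
      rw [show m + (2 * j + m + 1) = 2 * (m + j) + 1 by ring, spiral_two_mul_add_one,
        dist_eq_norm, ← mul_sub_one, norm_mul, norm_spiral, one_mul, hD, dist_eq_norm]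
    linarith [dist_triangle_right (spiral (m + (2 * j + m + 1))) (spiral (m + j)) c]
  have hsum := Finset.card_nsmul_le_sum (Finset.range M) _ D fun j _ => hpair j
  rw [Finset.sum_add_distrib, Finset.card_range, nsmul_eq_mul] at hsum
  have h1 : ∑ j ∈ Finset.range M, dist (spiral (m + j)) c
      ≤ ∑ j ∈ Finset.range (2 * M + m), dist (spiral (m + j)) c :=
    Finset.sum_le_sum_of_subset_of_nonneg (Finset.range_mono (by omega))
      fun _ _ _ => dist_nonneg
  have h2 : ∑ j ∈ Finset.range M, dist (spiral (m + (2 * j + m + 1))) c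
      ≤ ∑ j ∈ Finset.range (2 * M + m), dist (spiral (m + j)) c := by
    rw [← Finset.sum_image (g := fun j => 2 * j + m + 1)
      (f := fun j => dist (spiral (m + j)) c) fun a _ b _ h => by simpa using h]
    refine Finset.sum_le_sum_of_subset_of_nonneg (fun i hi => ?_) fun _ _ _ => dist_nonneg
    obtain ⟨j, hj, rfl⟩ := Finset.mem_image.1 hi
    rw [Finset.mem_range] at hj ⊢
    omega
  linarith

theorem dist_exp_log_two_pos : 0 < dist (Complex.exp ((Real.log 2 : ℝ) * Complex.I)) 1 := by
  rw [dist_pos]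
  intro h
  have him := congrArg Complex.im h
  rw [Complex.exp_ofReal_mul_I_im, Complex.one_im] at him
  have hlt : Real.log 2 < Real.pi := by
    linarith [Real.log_two_lt_d9, Real.pi_gt_three]
  exact (Real.sin_pos_of_pos_of_lt_pi (Real.log_pos one_lt_two) hlt).ne' him

instance : CompactSpace carrier := isCompact_iff_compactSpace.1 isCompact_carrier

theorem le_rhoBT_base_of_isFixedPt {p : carrier} (hp : Function.IsFixedPt step p) (m : ℕ) :
    dist (Complex.exp ((Real.log 2 : ℝ) * Complex.I)) 1 / 6 ≤ rhoBT step (base m) p := by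
  refine le_rhoBT_of_frequently (frequently_atTop.2 fun N => ?_)
  refine ⟨2 * (N + m + 1) + m, by omega, ?_⟩
  have h := sum_dist_spiral_ge p.1.2.2 m (N + m + 1)
  have hle : ∑ j ∈ Finset.range (2 * (N + m + 1) + m), dist (spiral (m + j)) p.1.2.2
      ≤ ∑ j ∈ Finset.range (2 * (N + m + 1) + m), dist (step^[j] (base m)) (step^[j] p) := by
    refine Finset.sum_le_sum fun j _ => ?_
    rw [(hp.iterate j).eq, Subtype.dist_eq, coe_iterate_step_base, Prod.dist_eq, Prod.dist_eq]
    exact (le_max_right _ _).trans (le_max_right _ _)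
  rw [one_div, le_inv_mul_iff₀ (by positivity)]
  push_cast at h ⊢
  nlinarith [dist_exp_log_two_pos, mul_nonneg N.cast_nonneg dist_exp_log_two_pos.le]

theorem dist_fst_le_rhoBT_base (p : carrier) (n : ℕ) :
    dist (1 / ((n : ℝ) + 1)) p.1.1 ≤ rhoBT step (base n) p := by
  refine le_rhoBT_of_forall_le fun j => ?_
  have hfst : (step^[j] p).1.1 = p.1.1 := by
    induction j with
    | zero => rfl
    | succ j ih => rwa [Function.iterate_succ_apply']
  rw [Subtype.dist_eq, Prod.dist_eq, coe_iterate_step_base, hfst]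
  exact le_max_left _ _

theorem isFixedPt_step {p : carrier} (hp : p.1.1 = 0) : Function.IsFixedPt step p := by
  have hr : p.1.2.1 = 0 := le_antisymm (p.2.2.1.trans hp.le) p.2.1
  refine Subtype.ext (Prod.ext rfl (Prod.ext ?_ ?_)) <;> simp [step, hr]

theorem not_tendsto_rhoBT_base (p : carrier) :
    ¬ Tendsto (fun n => rhoBT step (base n) p) atTop (nhds 0) := by
  intro h
  have hdist := (tendsto_one_div_add_atTop_nhds_zero_nat (𝕜 := ℝ)).dist
    (tendsto_const_nhds (x := p.1.1))
  have hle : dist 0 p.1.1 ≤ 0 := le_of_tendsto_of_tendsto' hdist h (dist_fst_le_rhoBT_base p)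
  have hp : p.1.1 = 0 := (dist_le_zero.1 hle).symm
  have := ge_of_tendsto' h (le_rhoBT_base_of_isFixedPt (isFixedPt_step hp))
  linarith [dist_exp_log_two_pos]

end SlowRotation

/-- There exists a topological dynamical system `(X,T)` on a compact metric space which is not
Besicovitch complete: some Besicovitch-Cauchy sequence has no Besicovitch limit in `X`. -/
theorem stmt11 :
    ∃ (X : Type) (_ : MetricSpace X) (_ : CompactSpace X) (T : X → X),
      Continuous T ∧
      ∃ z : ℕ → X, BesicovitchCauchy T z ∧
        ∀ p : X, ¬ Filter.Tendsto (fun n => rhoBT T (z n) p) Filter.atTop (nhds 0) :=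
  ⟨SlowRotation.carrier, inferInstance, inferInstance, SlowRotation.step,
    SlowRotation.continuous_step, SlowRotation.base, SlowRotation.besicovitchCauchy_base,
    SlowRotation.not_tendsto_rhoBT_base⟩
end
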